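/- Let G be a matrix over GF(2) with columns indexed by a finite set E, of rank r. For k ∈ {0,1,2,3}, let ℳ_{1,1}(k,4) be the set of pairs (f, g) of functions f, g : E → GF(2) such that f − g is a flow of G and |supp(f)| + |supp(g)| ≡ k mod 4. Then, with the indices |E|, |E|+1, |E|+2, |E|+3 reduced modulo 4: (i) |ℳ_{1,1}(|E|, 4)| − |ℳ_{1,1}(|E|+2, 4)| = 2^{|E|} χ(M(G); 2), and (ii) |ℳ_{1,1}(|E|+1, 4)| = |ℳ_{1,1}(|E|+3, 4)|. In particular, |ℳ_{1,1}(|E|, 4)| ≠ |ℳ_{1,1}(|E|+2, 4)| if and only if χ(M(G); 2) ≠ 0. -/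

import Mathlib

open Finset
/-- The dimension of the span of the columns of `G` indexed by `B`. -/
noncomputable def colRank {ι κ : Type*} (G : κ → ι → ZMod 2) (B : Finset ι) : ℕ :=
  Module.finrank (ZMod 2)
    (Submodule.span (ZMod 2) ((fun e => fun i => G i e) '' (B : Set ι)))

theorem finrank_map_restrict_rowSpace {ι κ : Type*} [Fintype κ]
    (G : κ → ι → ZMod 2) (B : Finset ι) :
    Module.finrank (ZMod 2) ((Submodule.span (ZMod 2) (Set.range G)).map
      (LinearMap.funLeft (ZMod 2) (ZMod 2) ((↑) : B → ι))) = colRank G B := by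
  classical
  let A : Matrix κ B (ZMod 2) := fun i e => G i e
  have h1 : Module.finrank (ZMod 2) ((Submodule.span (ZMod 2) (Set.range G)).map
      (LinearMap.funLeft (ZMod 2) (ZMod 2) ((↑) : B → ι))) = A.rank := by
    rw [A.rank_eq_finrank_span_row, Submodule.map_span, ← Set.range_comp]
    rfl
  rw [h1, A.rank_eq_finrank_span_cols, colRank, Set.image_eq_range]
  rfl

theorem card_rowSpace_vanishing {ι κ : Type*} [Fintype ι] [DecidableEq ι] [Fintype κ]
    (G : κ → ι → ZMod 2) (B : Finset ι)
    [DecidablePred (· ∈ Submodule.span (ZMod 2) (Set.range G))] :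
    (univ.filter (fun h : ι → ZMod 2 =>
      h ∈ Submodule.span (ZMod 2) (Set.range G) ∧ ∀ e ∈ B, h e = 0)).card
      = 2 ^ (colRank G univ - colRank G B) := by
  classical
  set R := Submodule.span (ZMod 2) (Set.range G) with hR
  let φ := LinearMap.funLeft (ZMod 2) (ZMod 2) ((↑) : B → ι)
  have hrank : Module.finrank (ZMod 2) R = colRank G univ := by
    rw [← finrank_map_restrict_rowSpace G univ]
    refine LinearEquiv.finrank_eq (Submodule.equivMapOfInjective _ ?_ R)
    exact LinearMap.funLeft_injective_of_surjective _ _ _ fun e => ⟨⟨e, mem_univ e⟩, rfl⟩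
  have hsum := LinearMap.finrank_range_add_finrank_ker (φ.domRestrict R)
  rw [LinearMap.range_domRestrict, finrank_map_restrict_rowSpace, hrank] at hsum
  have hker : Module.finrank (ZMod 2) (LinearMap.ker (φ.domRestrict R))
      = colRank G univ - colRank G B := by omega
  rw [← hker]
  have hcard := Module.natCard_eq_pow_finrank (K := ZMod 2)
    (V := LinearMap.ker (φ.domRestrict R))
  rw [Nat.card_zmod] at hcard
  rw [← hcard, ← Fintype.card_subtype, ← Nat.card_eq_fintype_card]
  refine Nat.card_congr
    { toFun := fun h => ⟨⟨h.1, h.2.1⟩, ?_⟩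
      invFun := fun h => ⟨h.1.1, h.1.2, fun e he => ?_⟩
      left_inv := fun _ => rfl
      right_inv := fun _ => rfl }
  · rw [LinearMap.mem_ker]
    funext e
    exact h.2.2 e e.2
  · exact congrFun (LinearMap.mem_ker.1 h.2) ⟨e, he⟩

/-- The characteristic polynomial at `2` counts the nowhere-zero vectors of the row space. -/
theorem card_rowSpace_nowhere_zero {ι κ : Type*} [Fintype ι] [DecidableEq ι] [Fintype κ]
    (G : κ → ι → ZMod 2)
    [DecidablePred (· ∈ Submodule.span (ZMod 2) (Set.range G))] :
    ((univ.filter (fun h : ι → ZMod 2 =>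
      h ∈ Submodule.span (ZMod 2) (Set.range G) ∧ ∀ e, h e ≠ 0)).card : ℤ)
      = ∑ B : Finset ι, (-1 : ℤ) ^ B.card * 2 ^ (colRank G univ - colRank G B) := by
  have hie (h : ι → ZMod 2) : (if ∀ e, h e ≠ 0 then (1 : ℤ) else 0)
      = ∑ B : Finset ι, (-1) ^ B.card * if ∀ e ∈ B, h e = 0 then 1 else 0 := by
    have hprod : (if ∀ e, h e ≠ 0 then (1 : ℤ) else 0)
        = ∏ e, (1 + -(if h e = 0 then (1 : ℤ) else 0)) := by
      split_ifs with hz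
      · simp [hz]
      · push Not at hz
        obtain ⟨e, he⟩ := hz
        exact (prod_eq_zero (mem_univ e) (by simp [he])).symm
    rw [hprod, prod_one_add, powerset_univ]
    refine sum_congr rfl fun B _ => ?_
    rw [prod_neg, prod_boole]
    congr!
  rw [← filter_filter, ← sum_boole, sum_congr rfl fun h _ => hie h, sum_comm]
  refine sum_congr rfl fun B _ => ?_
  rw [← mul_sum, sum_boole, filter_filter, card_rowSpace_vanishing]
  norm_cast

theorem sum_I_pow_support_add_support {ι : Type*} [Fintype ι] [DecidableEq ι]
    (h : ι → ZMod 2) :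
    ∑ f : ι → ZMod 2, Complex.I ^ ((univ.filter (fun e => f e ≠ 0)).card
        + (univ.filter (fun e => (f - h) e ≠ 0)).card)
      = if ∀ e, h e ≠ 0 then (2 * Complex.I) ^ Fintype.card ι else 0 := by
  have hterm (f : ι → ZMod 2) : Complex.I ^ ((univ.filter (fun e => f e ≠ 0)).card
        + (univ.filter (fun e => (f - h) e ≠ 0)).card)
      = ∏ e, ((if f e ≠ 0 then Complex.I else 1) * if f e - h e ≠ 0 then Complex.I else 1) := by
    rw [prod_mul_distrib, prod_ite, prod_ite, pow_add]
    simp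
  have hlocal (a : ZMod 2) : ∑ x : ZMod 2, ((if x ≠ 0 then Complex.I else 1)
      * if x - a ≠ 0 then Complex.I else 1) = if a ≠ 0 then 2 * Complex.I else 0 := by
    have huniv : (univ : Finset (ZMod 2)) = {0, 1} := rfl
    rw [huniv, sum_pair (by decide)]
    obtain rfl | rfl : a = 0 ∨ a = 1 := by revert a; decide
    · simp
    · simp [two_mul]
  rw [sum_congr rfl fun f _ => hterm f,
    ← Fintype.prod_sum fun e (x : ZMod 2) =>
      (if x ≠ 0 then Complex.I else 1) * if x - h e ≠ 0 then Complex.I else 1]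
  simp only [hlocal]
  split_ifs with hz
  · simp [hz]
  · push Not at hz
    obtain ⟨e, he⟩ := hz
    exact prod_eq_zero (mem_univ e) (by simp [he])


/-- **Corollary 4.15.** For a binary matrix `G`:
`|ℳ_{1,1}(|E|,4)| − |ℳ_{1,1}(|E|+2,4)| = 2^{|E|} χ(M(G);2)`,
`|ℳ_{1,1}(|E|+1,4)| = |ℳ_{1,1}(|E|+3,4)|`, and the affineness criterion. -/
theorem stmt_11
    {ι : Type*} [Fintype ι] [DecidableEq ι]
    {n : ℕ} (G : Fin n → ι → ZMod 2)
    (rk : Finset ι → ℕ)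
    (hrk : ∀ B : Finset ι,
      rk B = Module.finrank (ZMod 2)
        (Submodule.span (ZMod 2) ((fun e => fun i => G i e) '' (B : Set ι))))
    (r : ℕ) (hr : r = rk Finset.univ)
    (Flow : (ι → ZMod 2) → Prop) [DecidablePred Flow]
    (hFlow : ∀ h : ι → ZMod 2, Flow h ↔ h ∈ Submodule.span (ZMod 2) (Set.range G))
    (M : ℕ → ℕ)
    (hM : ∀ k : ℕ, M k = (Finset.univ.filter (fun p : (ι → ZMod 2) × (ι → ZMod 2) =>
        Flow (p.1 - p.2) ∧
          ((Finset.univ.filter (fun e => p.1 e ≠ 0)).card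
            + (Finset.univ.filter (fun e => p.2 e ≠ 0)).card) % 4 = k)).card) :
    ((M (Fintype.card ι % 4) : ℤ) - (M ((Fintype.card ι + 2) % 4) : ℤ)
        = 2 ^ (Fintype.card ι) *
            ∑ B : Finset ι, (-1 : ℤ) ^ B.card * 2 ^ (r - rk B)) ∧
    (M ((Fintype.card ι + 1) % 4) = M ((Fintype.card ι + 3) % 4)) ∧
    (M (Fintype.card ι % 4) ≠ M ((Fintype.card ι + 2) % 4) ↔
        ∑ B : Finset ι, (-1 : ℤ) ^ B.card * 2 ^ (r - rk B) ≠ 0) := by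
  classical
  obtain rfl : Flow = (· ∈ Submodule.span (ZMod 2) (Set.range G)) :=
    funext fun h => propext (hFlow h)
  obtain rfl : rk = colRank G := funext hrk
  subst hr
  rw [← card_rowSpace_nowhere_zero]
  set N := (univ.filter (fun h : ι → ZMod 2 =>
    h ∈ Submodule.span (ZMod 2) (Set.range G) ∧ ∀ e, h e ≠ 0)).card with hN
  let w (p : (ι → ZMod 2) × (ι → ZMod 2)) : ℕ :=
    (univ.filter (fun e => p.1 e ≠ 0)).card + (univ.filter (fun e => p.2 e ≠ 0)).card
  let S := univ.filter (fun p : (ι → ZMod 2) × (ι → ZMod 2) =>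
    p.1 - p.2 ∈ Submodule.span (ZMod 2) (Set.range G))
  have hfiber : ∑ p ∈ S, Complex.I ^ w p = ∑ k ∈ range 4, (M k : ℂ) * Complex.I ^ k := by
    rw [← sum_fiberwise_of_maps_to (g := fun p => w p % 4) (t := range 4)
      fun p _ => mem_range.2 (Nat.mod_lt _ (by norm_num))]
    refine sum_congr rfl fun k _ => ?_
    rw [hM, ← filter_filter, ← nsmul_eq_mul]
    refine sum_eq_card_nsmul fun p hp => ?_
    rw [Complex.I_pow_eq_pow_mod, (mem_filter.1 hp).2]
  have htotal : ∑ p ∈ S, Complex.I ^ w p = (2 * Complex.I) ^ Fintype.card ι * N := by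
    let swapDiff : (ι → ZMod 2) × (ι → ZMod 2) ≃ (ι → ZMod 2) × (ι → ZMod 2) :=
      { toFun := fun q => (q.2, q.2 - q.1)
        invFun := fun p => (p.1 - p.2, p.1)
        left_inv := fun q => by simp
        right_inv := fun p => by simp }
    rw [sum_filter, ← swapDiff.sum_comp, Fintype.sum_prod_type]
    simp only [swapDiff, Equiv.coe_fn_mk, sub_sub_cancel, w]
    rw [hN, ← filter_filter, ← nsmul_eq_mul', ← sum_const, sum_filter, sum_filter]
    refine sum_congr rfl fun h _ => ?_
    by_cases hh : h ∈ Submodule.span (ZMod 2) (Set.range G)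
    · simp only [hh, if_true]
      convert sum_I_pow_support_add_support h
    · simp [hh]
  have key := hfiber.symm.trans htotal
  set m := Fintype.card ι
  rw [mul_pow, Complex.I_pow_eq_pow_mod m] at key
  have hcast : (2 : ℂ) ^ m * N = (2 ^ m * N : ℕ) := by push_cast; rfl
  rw [mul_right_comm, hcast] at key
  have hcases : (M (m % 4) : ℤ) - M ((m + 2) % 4) = 2 ^ m * N ∧
      M ((m + 1) % 4) = M ((m + 3) % 4) := by
    have hlt := Nat.mod_lt m (show 4 > 0 by norm_num)
    have hcast' : (2 : ℤ) ^ m * N = (2 ^ m * N : ℕ) := by push_cast; rfl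
    rw [hcast', Nat.add_mod m 1, Nat.add_mod m 2, Nat.add_mod m 3]
    generalize m % 4 = s at hlt key ⊢
    generalize 2 ^ m * N = K at key ⊢
    have hI3 : Complex.I ^ 3 = -Complex.I := Complex.I_pow_three
    interval_cases s <;>
    · simp only [sum_range_succ, sum_range_zero, Complex.I_sq, hI3, pow_zero, pow_one] at key
      have hre := congrArg Complex.re key
      have him := congrArg Complex.im key
      simp at hre him
      norm_num
      constructor
      · rify
        linarith
      · rify
        linarith
  refine ⟨hcases.1, hcases.2, ?_⟩
  rw [← (Nat.cast_injective (R := ℤ)).ne_iff, ← sub_ne_zero, hcases.1]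
  simp
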